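/- Let h be a Haar state on O(SL_q(2)) and set ζ = −qbc. Then for every integer n ≥ 1, h(ζⁿ) = ((1 − q^{−2n})/(1 − q^{−2(n+1)})) · h(ζ^{n−1}). -/

import Mathlib

open scoped TensorProduct
open LaurentPolynomial

noncomputable section

namespace SLq2

/-- Free algebra on the four generators `a, b, c, d` (indexed `0,1,2,3`). -/
abbrev F : Type := FreeAlgebra ℂ (Fin 4)

/-- The generators of the free algebra. -/
def X (i : Fin 4) : F := FreeAlgebra.ι ℂ i

/-- The defining relations of `O(SL_q(2))`:
`ab = q ba`, `ac = q ca`, `bd = q db`, `cd = q dc`, `bc = cb`,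
`ad - da = (q - q⁻¹) bc`, `ad - q bc = 1`. -/
inductive Rel (q : ℝ) : F → F → Prop
  | ab : Rel q (X 0 * X 1) ((q : ℂ) • (X 1 * X 0))
  | ac : Rel q (X 0 * X 2) ((q : ℂ) • (X 2 * X 0))
  | bd : Rel q (X 1 * X 3) ((q : ℂ) • (X 3 * X 1))
  | cd : Rel q (X 2 * X 3) ((q : ℂ) • (X 3 * X 2))
  | bc : Rel q (X 1 * X 2) (X 2 * X 1)
  | adda : Rel q (X 0 * X 3 - X 3 * X 0) (((q : ℂ) - (q : ℂ)⁻¹) • (X 1 * X 2))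
  | det : Rel q (X 0 * X 3 - (q : ℂ) • (X 1 * X 2)) 1

/-- `O(SL_q(2))`, the universal `ℂ`-algebra on `a,b,c,d` with the above relations. -/
abbrev A (q : ℝ) : Type := RingQuot (Rel q)

def a (q : ℝ) : A q := RingQuot.mkAlgHom ℂ (Rel q) (X 0)
def b (q : ℝ) : A q := RingQuot.mkAlgHom ℂ (Rel q) (X 1)
def c (q : ℝ) : A q := RingQuot.mkAlgHom ℂ (Rel q) (X 2)
def d (q : ℝ) : A q := RingQuot.mkAlgHom ℂ (Rel q) (X 3)

variable {q : ℝ}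

/-- `L_K = (φ ⊗ id) ∘ Δ`. -/
def LK (Δ : A q →ₐ[ℂ] A q ⊗[ℂ] A q) (φ : A q →ₐ[ℂ] LaurentPolynomial ℂ) :
    A q →ₗ[ℂ] LaurentPolynomial ℂ ⊗[ℂ] A q :=
  (TensorProduct.map φ.toLinearMap LinearMap.id).comp Δ.toLinearMap

/-- `R_K = (id ⊗ φ) ∘ Δ`. -/
def RK (Δ : A q →ₐ[ℂ] A q ⊗[ℂ] A q) (φ : A q →ₐ[ℂ] LaurentPolynomial ℂ) :
    A q →ₗ[ℂ] A q ⊗[ℂ] LaurentPolynomial ℂ :=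
  (TensorProduct.map LinearMap.id φ.toLinearMap).comp Δ.toLinearMap

/-- The subspace `A[m,n] = {x | L_K x = zᵐ ⊗ x, R_K x = x ⊗ zⁿ}`. -/
def Asub (Δ : A q →ₐ[ℂ] A q ⊗[ℂ] A q) (φ : A q →ₐ[ℂ] LaurentPolynomial ℂ)
    (m n : ℤ) : Submodule ℂ (A q) where
  carrier := {x | LK Δ φ x = T m ⊗ₜ[ℂ] x ∧ RK Δ φ x = x ⊗ₜ[ℂ] T n}
  add_mem' := by
    rintro x y ⟨hx1, hx2⟩ ⟨hy1, hy2⟩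
    exact ⟨by simp [map_add, hx1, hy1, TensorProduct.tmul_add],
           by simp [map_add, hx2, hy2, TensorProduct.add_tmul]⟩
  zero_mem' := ⟨by simp, by simp⟩
  smul_mem' := by
    rintro t x ⟨h1, h2⟩
    exact ⟨by simp [map_smul, h1, TensorProduct.tmul_smul],
           by simp [map_smul, h2, TensorProduct.smul_tmul']⟩

/-- `h` is a Haar state: `h(1) = 1`, `(id ⊗ h)(Δ x) = h(x)·1` and `(h ⊗ id)(Δ x) = h(x)·1`. -/
def IsHaarState (Δ : A q →ₐ[ℂ] A q ⊗[ℂ] A q) (h : A q →ₗ[ℂ] ℂ) : Prop :=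
  h 1 = 1 ∧
  (∀ x : A q, (TensorProduct.rid ℂ (A q)) ((LinearMap.lTensor (A q) h) (Δ x)) = h x • 1) ∧
  (∀ x : A q, (TensorProduct.lid ℂ (A q)) ((LinearMap.rTensor (A q) h) (Δ x)) = h x • 1)
lemma a_mul_b : a q * b q = (q : ℂ) • (b q * a q) := by
  simpa [a, b, -Complex.coe_smul] using RingQuot.mkAlgHom_rel ℂ (Rel.ab (q := q))

lemma a_mul_c : a q * c q = (q : ℂ) • (c q * a q) := by
  simpa [a, c, -Complex.coe_smul] using RingQuot.mkAlgHom_rel ℂ (Rel.ac (q := q))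

lemma b_mul_c : b q * c q = c q * b q := by
  simpa [b, c] using RingQuot.mkAlgHom_rel ℂ (Rel.bc (q := q))

lemma a_mul_d : a q * d q = 1 + (q : ℂ) • (b q * c q) := by
  have h : a q * d q - (q : ℂ) • (b q * c q) = 1 := by
    simpa [a, b, c, d, -Complex.coe_smul] using RingQuot.mkAlgHom_rel ℂ (Rel.det (q := q))
  rw [← h, sub_add_cancel]

/-- Images of the generators under the triangular representation `triangularRep`. -/
def triangularGen (q : ℝ) : Fin 4 → Matrix (Fin 2) (Fin 2) ℂ :=
  ![!![(q : ℂ), 0; 0, 1], !![0, 1; 0, 0], 0, !![(q : ℂ)⁻¹, 0; 0, 1]]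

/-- A two-dimensional representation of `O(SL_q(2))` by upper triangular matrices. Its
off-diagonal coefficient is a twisted derivation, dual to a generator of `U_q(sl₂)`. -/
def triangularRep (hq : q ≠ 0) : A q →ₐ[ℂ] Matrix (Fin 2) (Fin 2) ℂ :=
  RingQuot.liftAlgHom ℂ ⟨FreeAlgebra.lift ℂ (triangularGen q), by
    have hq' : (q : ℂ) ≠ 0 := by exact_mod_cast hq
    rintro x y (_ | _ | _ | _ | _ | _ | _) <;>
      simp [X, triangularGen, hq', Matrix.one_fin_two, -Complex.coe_smul]
    ext i
    fin_cases i <;> rfl⟩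

lemma triangularRep_mk (hq : q ≠ 0) (i : Fin 4) :
    triangularRep hq (RingQuot.mkAlgHom ℂ (Rel q) (X i)) = triangularGen q i := by
  simp [triangularRep, X]

/-- The algebra homomorphism `(id ⊗ triangularRep) ∘ Δ`, with values in matrices over
`O(SL_q(2))`. -/
def coactRep (hq : q ≠ 0) (Δ : A q →ₐ[ℂ] A q ⊗[ℂ] A q) :
    A q →ₐ[ℂ] Matrix (Fin 2) (Fin 2) (A q) :=
  ((matrixEquivTensor (Fin 2) ℂ (A q)).symm.toAlgHom.comp
    (Algebra.TensorProduct.map (AlgHom.id ℂ (A q)) (triangularRep hq))).comp Δ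

lemma matrixEquivTensor_symm_map_tmul (hq : q ≠ 0) (x y : A q) :
    (matrixEquivTensor (Fin 2) ℂ (A q)).symm
      (Algebra.TensorProduct.map (AlgHom.id ℂ (A q)) (triangularRep hq) (x ⊗ₜ[ℂ] y)) =
      (triangularRep hq y).map (fun t => t • x) := by
  ext i j
  simp [Algebra.smul_def, Algebra.commutes]

/-- An invariant functional kills the off-diagonal coefficient of `coactRep`. -/
lemma haar_coactRep (hq : q ≠ 0) {Δ : A q →ₐ[ℂ] A q ⊗[ℂ] A q} {h : A q →ₗ[ℂ] ℂ}
    (hh : IsHaarState Δ h) (x : A q) : h (coactRep hq Δ x 0 1) = 0 := by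
  have key : ∀ t : A q ⊗[ℂ] A q,
      h ((matrixEquivTensor (Fin 2) ℂ (A q)).symm
        (Algebra.TensorProduct.map (AlgHom.id ℂ (A q)) (triangularRep hq) t) 0 1) =
      triangularRep hq (TensorProduct.lid ℂ (A q) (LinearMap.rTensor (A q) h t)) 0 1 := by
    intro t
    induction t with
    | zero => simp
    | add s t hs ht => simp only [map_add, Matrix.add_apply, hs, ht]
    | tmul x y =>
      rw [matrixEquivTensor_symm_map_tmul]
      simp [mul_comm]
  have := key (Δ x)
  rw [hh.2.2 x] at this
  simpa [coactRep] using this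

section Coaction

variable {Δ : A q →ₐ[ℂ] A q ⊗[ℂ] A q}

lemma coactRep_b (hq : q ≠ 0) (hΔb : Δ (b q) = a q ⊗ₜ[ℂ] b q + b q ⊗ₜ[ℂ] d q) :
    coactRep hq Δ (b q) = !![(q : ℂ)⁻¹ • b q, a q; 0, b q] := by
  change (matrixEquivTensor (Fin 2) ℂ (A q)).symm (Algebra.TensorProduct.map
    (AlgHom.id ℂ (A q)) (triangularRep hq) (Δ (b q))) = _
  rw [hΔb, map_add, map_add, matrixEquivTensor_symm_map_tmul, matrixEquivTensor_symm_map_tmul,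
    b, d, triangularRep_mk, triangularRep_mk]
  ext i j
  fin_cases i <;> fin_cases j <;> simp [triangularGen]

lemma coactRep_c (hq : q ≠ 0) (hΔc : Δ (c q) = c q ⊗ₜ[ℂ] a q + d q ⊗ₜ[ℂ] c q) :
    coactRep hq Δ (c q) = !![(q : ℂ) • c q, 0; 0, c q] := by
  change (matrixEquivTensor (Fin 2) ℂ (A q)).symm (Algebra.TensorProduct.map
    (AlgHom.id ℂ (A q)) (triangularRep hq) (Δ (c q))) = _
  rw [hΔc, map_add, map_add, matrixEquivTensor_symm_map_tmul, matrixEquivTensor_symm_map_tmul,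
    a, c, triangularRep_mk, triangularRep_mk]
  ext i j
  fin_cases i <;> fin_cases j <;> simp [triangularGen]

lemma coactRep_d (hq : q ≠ 0) (hΔd : Δ (d q) = c q ⊗ₜ[ℂ] b q + d q ⊗ₜ[ℂ] d q) :
    coactRep hq Δ (d q) = !![(q : ℂ)⁻¹ • d q, c q; 0, d q] := by
  change (matrixEquivTensor (Fin 2) ℂ (A q)).symm (Algebra.TensorProduct.map
    (AlgHom.id ℂ (A q)) (triangularRep hq) (Δ (d q))) = _
  rw [hΔd, map_add, map_add, matrixEquivTensor_symm_map_tmul, matrixEquivTensor_symm_map_tmul,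
    b, d, triangularRep_mk, triangularRep_mk]
  ext i j
  fin_cases i <;> fin_cases j <;> simp [triangularGen]

lemma coactRep_bc (hq : q ≠ 0) (hΔb : Δ (b q) = a q ⊗ₜ[ℂ] b q + b q ⊗ₜ[ℂ] d q)
    (hΔc : Δ (c q) = c q ⊗ₜ[ℂ] a q + d q ⊗ₜ[ℂ] c q) :
    coactRep hq Δ (b q * c q) = !![b q * c q, a q * c q; 0, b q * c q] := by
  have hq' : (q : ℂ) ≠ 0 := by exact_mod_cast hq
  rw [map_mul, coactRep_b hq hΔb, coactRep_c hq hΔc]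
  simp [smul_smul, hq']

lemma coactRep_bd (hq : q ≠ 0) (hΔb : Δ (b q) = a q ⊗ₜ[ℂ] b q + b q ⊗ₜ[ℂ] d q)
    (hΔd : Δ (d q) = c q ⊗ₜ[ℂ] b q + d q ⊗ₜ[ℂ] d q) :
    coactRep hq Δ (b q * d q) =
      !![((q : ℂ)⁻¹ * (q : ℂ)⁻¹) • (b q * d q), (q : ℂ)⁻¹ • (b q * c q) + a q * d q;
        0, b q * d q] := by
  rw [map_mul, coactRep_b hq hΔb, coactRep_d hq hΔd]
  simp [smul_smul]

lemma a_mul_c_mul_bc_pow (m : ℕ) :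
    a q * c q * (b q * c q) ^ m = ((q : ℂ) ^ 2) ^ m • ((b q * c q) ^ m * (a q * c q)) := by
  have base : a q * c q * (b q * c q) = (q : ℂ) ^ 2 • (b q * c q * (a q * c q)) := by
    calc a q * c q * (b q * c q) = (a q * b q) * c q * c q := by
          simp only [mul_assoc, ← mul_assoc (c q) (b q), ← b_mul_c]
      _ = (q : ℂ) • (b q * (a q * c q) * c q) := by
          rw [a_mul_b]; simp only [smul_mul_assoc, mul_assoc]
      _ = (q : ℂ) • (q : ℂ) • (b q * c q * (a q * c q)) := by
          conv_lhs => rw [a_mul_c]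
          simp only [smul_mul_assoc, mul_smul_comm, mul_assoc]
      _ = _ := by rw [smul_smul, pow_two]
  induction m with
  | zero => simp
  | succ m ih =>
    rw [pow_succ (b q * c q), ← mul_assoc, ih, smul_mul_assoc, mul_assoc, base, mul_smul_comm,
      smul_smul, ← mul_assoc, ← pow_succ]

lemma ac_mul_bd :
    a q * c q * (b q * d q) = (q : ℂ) ^ 2 • (b q * c q * (1 + (q : ℂ) • (b q * c q))) := by
  calc a q * c q * (b q * d q) = (a q * b q) * c q * d q := by
        simp only [mul_assoc, ← mul_assoc (c q) (b q), ← b_mul_c]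
    _ = (q : ℂ) • (b q * (a q * c q) * d q) := by
        rw [a_mul_b]; simp only [smul_mul_assoc, mul_assoc]
    _ = (q : ℂ) • (q : ℂ) • (b q * c q * (a q * d q)) := by
        rw [a_mul_c]; simp only [smul_mul_assoc, mul_smul_comm, mul_assoc]
    _ = _ := by rw [smul_smul, pow_two, a_mul_d]

lemma coactRep_bc_pow (hq : q ≠ 0) (hΔb : Δ (b q) = a q ⊗ₜ[ℂ] b q + b q ⊗ₜ[ℂ] d q)
    (hΔc : Δ (c q) = c q ⊗ₜ[ℂ] a q + d q ⊗ₜ[ℂ] c q) (m : ℕ) :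
    ∃ p : A q, coactRep hq Δ ((b q * c q) ^ m) = !![(b q * c q) ^ m, p; 0, (b q * c q) ^ m] ∧
      p * (b q * d q) = ((q : ℂ) ^ 2 * ∑ i ∈ Finset.range m, ((q : ℂ) ^ 2) ^ i) •
        ((b q * c q) ^ m * (1 + (q : ℂ) • (b q * c q))) := by
  induction m with
  | zero => exact ⟨0, by simp [Matrix.one_fin_two], by simp⟩
  | succ m ih =>
    obtain ⟨p, hp, hpd⟩ := ih
    refine ⟨b q * c q * p + a q * c q * (b q * c q) ^ m, ?_, ?_⟩
    · rw [pow_succ', map_mul, hp, coactRep_bc hq hΔb hΔc]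
      simp
    · rw [add_mul, mul_assoc (b q * c q), hpd, a_mul_c_mul_bc_pow, smul_mul_assoc,
        mul_assoc _ (a q * c q), ac_mul_bd, mul_smul_comm, mul_smul_comm, smul_smul, ← mul_assoc,
        ← mul_assoc,
        ← pow_succ', ← pow_succ, ← pow_succ, ← add_smul, Finset.sum_range_succ]
      congr 1
      ring

/-- The recursion for the values of the Haar state on powers of `bc`. -/
lemma haar_bc_pow_succ (hq : q ≠ 0) (hΔb : Δ (b q) = a q ⊗ₜ[ℂ] b q + b q ⊗ₜ[ℂ] d q)
    (hΔc : Δ (c q) = c q ⊗ₜ[ℂ] a q + d q ⊗ₜ[ℂ] c q)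
    (hΔd : Δ (d q) = c q ⊗ₜ[ℂ] b q + d q ⊗ₜ[ℂ] d q)
    {h : A q →ₗ[ℂ] ℂ} (hh : IsHaarState Δ h) (m : ℕ) :
    (∑ i ∈ Finset.range (m + 2), ((q : ℂ) ^ 2) ^ i) * h ((b q * c q) ^ (m + 1)) =
      -(q * ∑ i ∈ Finset.range (m + 1), ((q : ℂ) ^ 2) ^ i) * h ((b q * c q) ^ m) := by
  have hq' : (q : ℂ) ≠ 0 := by exact_mod_cast hq
  obtain ⟨p, hp, hpd⟩ := coactRep_bc_pow hq hΔb hΔc m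
  have key := haar_coactRep hq hh ((b q * c q) ^ m * (b q * d q))
  have entry : coactRep hq Δ ((b q * c q) ^ m * (b q * d q)) 0 1 =
      (b q * c q) ^ m * ((q : ℂ)⁻¹ • (b q * c q) + a q * d q) + p * (b q * d q) := by
    rw [map_mul, hp, coactRep_bd hq hΔb hΔd]
    simp
  rw [entry, hpd, a_mul_d] at key
  simp only [mul_add, mul_one, mul_smul_comm, ← pow_succ, map_add, map_smul, smul_eq_mul] at key
  rw [geom_sum_succ (n := m + 1), geom_sum_succ (n := m)]
  field_simp at key
  linear_combination key

end Coaction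

/-- For a Haar state `h` on `O(SL_q(2))` and `ζ = −q·bc`, for every
`n ≥ 1`, `h(ζⁿ) = ((1 − q^{−2n})/(1 − q^{−2(n+1)})) · h(ζ^{n−1})`. -/
theorem slq2_haar_zeta_pow (q : ℝ) (hq0 : 0 < q) (hq1 : q < 1)
    (Δ : A q →ₐ[ℂ] A q ⊗[ℂ] A q)
    (hΔa : Δ (a q) = a q ⊗ₜ[ℂ] a q + b q ⊗ₜ[ℂ] c q)
    (hΔb : Δ (b q) = a q ⊗ₜ[ℂ] b q + b q ⊗ₜ[ℂ] d q)
    (hΔc : Δ (c q) = c q ⊗ₜ[ℂ] a q + d q ⊗ₜ[ℂ] c q)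
    (hΔd : Δ (d q) = c q ⊗ₜ[ℂ] b q + d q ⊗ₜ[ℂ] d q)
    (h : A q →ₗ[ℂ] ℂ) (hh : IsHaarState Δ h) :
    ∀ n : ℕ, 1 ≤ n →
      h (((-(q : ℂ)) • (b q * c q)) ^ n) =
        ((1 - (q : ℂ) ^ (-(2 * (n : ℤ)))) / (1 - (q : ℂ) ^ (-(2 * ((n : ℤ) + 1))))) *
          h (((-(q : ℂ)) • (b q * c q)) ^ (n - 1)) := by
  intro n hn
  obtain ⟨m, rfl⟩ : ∃ m, n = m + 1 := ⟨n - 1, by omega⟩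
  have hq : (q : ℂ) ≠ 0 := by exact_mod_cast hq0.ne'
  have hpow : ∀ k : ℕ, ((q : ℂ) ^ 2) ^ (k + 1) ≠ 1 := by
    intro k
    rw [← pow_mul]
    exact_mod_cast (pow_lt_one₀ hq0.le hq1 (by omega)).ne
  have hzpow : ∀ k : ℕ, (q : ℂ) ^ (-(2 * (k : ℤ))) = (((q : ℂ) ^ 2) ^ k)⁻¹ := by
    intro k
    rw [zpow_neg, ← pow_mul]
    norm_cast
  have hrec := haar_bc_pow_succ hq0.ne' hΔb hΔc hΔd hh m
  have h1 : (q : ℂ) ^ 2 ≠ 1 := by simpa using hpow 0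
  rw [geom_sum_eq h1, geom_sum_eq h1] at hrec
  have hz2 : (q : ℂ) ^ (-(2 * (((m + 1 : ℕ) : ℤ) + 1))) = (((q : ℂ) ^ 2) ^ (m + 2))⁻¹ :=
    mod_cast hzpow (m + 2)
  rw [hzpow (m + 1), hz2, Nat.add_sub_cancel, smul_pow, smul_pow, map_smul, map_smul, smul_eq_mul,
    smul_eq_mul]
  have hsub1 : (q : ℂ) ^ 2 - 1 ≠ 0 := sub_ne_zero.mpr h1
  have hsub2 : ((q : ℂ) ^ 2) ^ (m + 2) - 1 ≠ 0 := sub_ne_zero.mpr (hpow (m + 1))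
  have hu : h ((b q * c q) ^ (m + 1)) =
      -q * (((q : ℂ) ^ 2) ^ (m + 1) - 1) / (((q : ℂ) ^ 2) ^ (m + 2) - 1) *
        h ((b q * c q) ^ m) := by
    field_simp at hrec ⊢
    linear_combination hrec
  have hratio : (1 - (((q : ℂ) ^ 2) ^ (m + 1))⁻¹) / (1 - (((q : ℂ) ^ 2) ^ (m + 2))⁻¹) =
      (q : ℂ) ^ 2 * (((q : ℂ) ^ 2) ^ (m + 1) - 1) / (((q : ℂ) ^ 2) ^ (m + 2) - 1) := by
    have hsub3 : 1 - (((q : ℂ) ^ 2) ^ (m + 2))⁻¹ ≠ 0 := by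
      rw [sub_ne_zero, ne_comm, Ne, inv_eq_one]
      exact hpow (m + 1)
    rw [div_eq_div_iff hsub3 hsub2]
    have hQ : ((q : ℂ) ^ 2) ≠ 0 := pow_ne_zero 2 hq
    generalize (q : ℂ) ^ 2 = Q at hQ
    field_simp
    ring
  rw [hu, hratio]
  ring

end SLq2
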